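/- There exist universal constants c, C > 0 such that the following holds. Let X and Y be finite nonempty sets, let A ∈ {0,1}^{X×Y}, let ε ∈ (0,1) and d ≥ 1. Then there exist an integer L ≥ 1 and tuples {(X_ℓ, Y_ℓ, A_ℓ)}_{ℓ=1}^L with nonempty X_ℓ ⊆ X, nonempty Y_ℓ ⊆ Y, and A_ℓ ∈ {0,1}^{X_ℓ×Y_ℓ}, such that: (1) for every (x,y) ∈ X×Y, A(x,y) = Σ_{ℓ : x∈X_ℓ, y∈Y_ℓ} A_ℓ(x,y); (2) for every ℓ ∈ [L], either E[A_ℓ] ≤ 2^{−d}, or A_ℓ is (ε,2,d)-regular and ε-min-degree; (3) Σ_{ℓ=1}^L |X_ℓ|·|Y_ℓ| ≤ (d+2)·|X|·|Y|; (4) L ≤ exp(C·d^3·ε^{−c}) and min_{ℓ∈[L]} |X_ℓ|·|Y_ℓ| ≥ exp(−C·d^3·ε^{−c})·|X|·|Y|. -/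

import Mathlib

open Finset

/-- The density `E[A]` of a matrix restricted to the rectangle `Sx × Sy`. -/
noncomputable def density {X Y : Type*} (Sx : Finset X) (Sy : Finset Y) (A : X → Y → ℝ) : ℝ :=
  (∑ x ∈ Sx, ∑ y ∈ Sy, A x y) / ((Sx.card : ℝ) * (Sy.card : ℝ))

/-- The (relative) degree `deg_A(x)` of a row `x`, with columns restricted to `Sy`. -/
noncomputable def rowDeg {X Y : Type*} (Sy : Finset Y) (A : X → Y → ℝ) (x : X) : ℝ :=
  (∑ y ∈ Sy, A x y) / (Sy.card : ℝ)

/-- The `(k,ℓ)`-grid norm `‖A‖_{U(k,ℓ)}` of a matrix restricted to the rectangle `Sx × Sy`: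
the `(kℓ)`-th root of the average of `∏_{i,j} A(x_i, y_j)` over all tuples
`x_1, …, x_k ∈ Sx`, `y_1, …, y_ℓ ∈ Sy`. -/
noncomputable def gridNorm {X Y : Type*} (Sx : Finset X) (Sy : Finset Y) (k l : ℕ)
    (A : X → Y → ℝ) : ℝ :=
  ((∑ xs ∈ Fintype.piFinset (fun _ : Fin k => Sx),
      ∑ ys ∈ Fintype.piFinset (fun _ : Fin l => Sy),
      ∏ i : Fin k, ∏ j : Fin l, A (xs i) (ys j)) /
    ((Sx.card : ℝ) ^ k * (Sy.card : ℝ) ^ l)) ^ ((1 : ℝ) / (k * l))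

/-- `A` (restricted to `Sx × Sy`) is `(ε,k,ℓ)`-regular if `‖A‖_{U(k,ℓ)} ≤ (1+ε)·E[A]`. -/
def GridRegular {X Y : Type*} (Sx : Finset X) (Sy : Finset Y) (ε : ℝ) (k l : ℕ)
    (A : X → Y → ℝ) : Prop :=
  gridNorm Sx Sy k l A ≤ (1 + ε) * density Sx Sy A

/-- `A` (restricted to `Sx × Sy`) is `ε`-min-degree if every row has degree
at least `(1-ε)·E[A]`. -/
def MinDegree {X Y : Type*} (Sx : Finset X) (Sy : Finset Y) (ε : ℝ) (A : X → Y → ℝ) : Prop :=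
  ∀ x ∈ Sx, (1 - ε) * density Sx Sy A ≤ rowDeg Sy A x

/-- `A` is a zero-one matrix on the rectangle `Sx × Sy`. -/
def ZeroOne {X Y : Type*} (Sx : Finset X) (Sy : Finset Y) (A : X → Y → ℝ) : Prop :=
  ∀ x ∈ Sx, ∀ y ∈ Sy, A x y = 0 ∨ A x y = 1

lemma sum_eq_density_mul {X Y : Type*} {Sx : Finset X} {Sy : Finset Y} (hx : Sx.Nonempty)
    (hy : Sy.Nonempty) (A : X → Y → ℝ) :
    ∑ x ∈ Sx, ∑ y ∈ Sy, A x y = density Sx Sy A * ((Sx.card : ℝ) * (Sy.card : ℝ)) := by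
  have hx' : (0 : ℝ) < Sx.card := by exact_mod_cast hx.card_pos
  have hy' : (0 : ℝ) < Sy.card := by exact_mod_cast hy.card_pos
  unfold density
  field_simp

lemma ZeroOne.mono {X Y : Type*} {Sx Sx' : Finset X} {Sy Sy' : Finset Y} {A : X → Y → ℝ}
    (hA : ZeroOne Sx Sy A) (hx : Sx' ⊆ Sx) (hy : Sy' ⊆ Sy) : ZeroOne Sx' Sy' A :=
  fun x hx' y hy' => hA x (hx hx') y (hy hy')

lemma ZeroOne.nonneg {X Y : Type*} {Sx : Finset X} {Sy : Finset Y} {A : X → Y → ℝ}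
    (hA : ZeroOne Sx Sy A) {x : X} (hx : x ∈ Sx) {y : Y} (hy : y ∈ Sy) : 0 ≤ A x y := by
  rcases hA x hx y hy with h | h <;> simp [h]

lemma ZeroOne.le_one {X Y : Type*} {Sx : Finset X} {Sy : Finset Y} {A : X → Y → ℝ}
    (hA : ZeroOne Sx Sy A) {x : X} (hx : x ∈ Sx) {y : Y} (hy : y ∈ Sy) : A x y ≤ 1 := by
  rcases hA x hx y hy with h | h <;> simp [h]

lemma ZeroOne.density_le_one {X Y : Type*} {Sx : Finset X} {Sy : Finset Y} {A : X → Y → ℝ}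
    (hA : ZeroOne Sx Sy A) : density Sx Sy A ≤ 1 := by
  refine div_le_one_of_le₀ ?_ (by positivity)
  calc ∑ x ∈ Sx, ∑ y ∈ Sy, A x y ≤ ∑ x ∈ Sx, ∑ y ∈ Sy, (1 : ℝ) :=
        Finset.sum_le_sum fun x hx => Finset.sum_le_sum fun y hy => hA.le_one hx hy
    _ = _ := by simp

/-- If no large subrectangle of `X' × Sy` is much denser than `β`, then the column sums over `X'`
have small second moment. -/
lemma sum_sq_colSum_le {X Y : Type*} {X' : Finset X} {Sy : Finset Y} {A : X → Y → ℝ}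
    {ε β : ℝ} (hε : ε ∈ Set.Ioo (0 : ℝ) 1) (hβ : 0 < β) (hX' : X'.Nonempty) (hSy : Sy.Nonempty)
    (hA : ZeroOne X' Sy A)
    (H : ∀ Y' ⊆ Sy, Y'.Nonempty → ε / 4 * β ^ 2 * Sy.card ≤ Y'.card →
      density X' Y' A ≤ (1 + ε / 4) * β) :
    ∑ y ∈ Sy, (∑ x ∈ X', A x y) ^ 2 ≤ (1 + ε) * β ^ 2 * (X'.card : ℝ) ^ 2 * Sy.card := by
  obtain ⟨hε0, hε1⟩ := hε
  have hcx : (0 : ℝ) < X'.card := by exact_mod_cast hX'.card_pos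
  have hcy : (0 : ℝ) < Sy.card := by exact_mod_cast hSy.card_pos
  set P : Y → Prop := fun y => (1 + ε / 4) * β * X'.card < ∑ x ∈ X', A x y with hP
  classical
  have hsmall : ((Sy.filter P).card : ℝ) ≤ ε / 4 * β ^ 2 * Sy.card := by
    by_contra! hlt
    have hne : (Sy.filter P).Nonempty := by
      rw [← Finset.card_pos]
      have : (0 : ℝ) < (Sy.filter P).card := lt_trans (by positivity) hlt
      exact_mod_cast this
    have h1 := H _ (Finset.filter_subset P Sy) hne hlt.le
    have h2 := sum_eq_density_mul hX' hne A
    rw [Finset.sum_comm] at h2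
    have h3 : ∑ y ∈ Sy.filter P, (1 + ε / 4) * β * X'.card
        < ∑ y ∈ Sy.filter P, ∑ x ∈ X', A x y :=
      Finset.sum_lt_sum_of_nonempty hne fun y hy => (Finset.mem_filter.1 hy).2
    rw [h2, Finset.sum_const, nsmul_eq_mul] at h3
    have h4 : (0 : ℝ) < (Sy.filter P).card := by exact_mod_cast hne.card_pos
    have := mul_le_mul_of_nonneg_right h1 (mul_pos hcx h4).le
    linarith
  have hcol : ∀ y ∈ Sy, (∑ x ∈ X', A x y) ^ 2 ≤
      (if P y then (X'.card : ℝ) ^ 2 else 0) + ((1 + ε / 4) * β * X'.card) ^ 2 := by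
    intro y hy
    have h0 : 0 ≤ ∑ x ∈ X', A x y := Finset.sum_nonneg fun x hx => hA.nonneg hx hy
    split_ifs with h
    · have h1 : ∑ x ∈ X', A x y ≤ X'.card := by
        calc ∑ x ∈ X', A x y ≤ ∑ x ∈ X', (1 : ℝ) :=
              Finset.sum_le_sum fun x hx => hA.le_one hx hy
          _ = _ := by simp
      have := pow_le_pow_left₀ h0 h1 2
      nlinarith [sq_nonneg ((1 + ε / 4) * β * X'.card)]
    · have := pow_le_pow_left₀ h0 (not_lt.1 h) 2
      linarith
  calc ∑ y ∈ Sy, (∑ x ∈ X', A x y) ^ 2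
      ≤ ∑ y ∈ Sy, ((if P y then (X'.card : ℝ) ^ 2 else 0) + ((1 + ε / 4) * β * X'.card) ^ 2) :=
        Finset.sum_le_sum hcol
    _ = (Sy.filter P).card * (X'.card : ℝ) ^ 2 + Sy.card * ((1 + ε / 4) * β * X'.card) ^ 2 := by
        rw [Finset.sum_add_distrib, ← Finset.sum_filter]; simp
    _ ≤ (ε / 4 * β ^ 2 * Sy.card) * (X'.card : ℝ) ^ 2
          + Sy.card * ((1 + ε / 4) * β * X'.card) ^ 2 := by gcongr
    _ = (ε / 4 + (1 + ε / 4) ^ 2) * (β ^ 2 * (X'.card : ℝ) ^ 2 * Sy.card) := by ring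
    _ ≤ (1 + ε) * (β ^ 2 * (X'.card : ℝ) ^ 2 * Sy.card) :=
        mul_le_mul_of_nonneg_right (by nlinarith) (by positivity)
    _ = _ := by ring

/-- The `(2, k)`-grid count of `A` on `Sx × Sy`, as the `k`-th moment of the codegrees. -/
noncomputable def codegMoment {X Y : Type*} (Sx : Finset X) (Sy : Finset Y) (A : X → Y → ℝ)
    (k : ℕ) : ℝ :=
  ∑ x₁ ∈ Sx, ∑ x₂ ∈ Sx, (∑ y ∈ Sy, A x₁ y * A x₂ y) ^ k

lemma codeg_pow {X Y : Type*} (Sy : Finset Y) (A : X → Y → ℝ) (k : ℕ) (x₁ x₂ : X) :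
    (∑ y ∈ Sy, A x₁ y * A x₂ y) ^ k =
      ∑ ys ∈ Fintype.piFinset (fun _ : Fin k => Sy),
        (∏ j, A x₁ (ys j)) * ∏ j, A x₂ (ys j) := by
  have := Finset.prod_univ_sum (fun _ : Fin k => Sy) (fun _ y => A x₁ y * A x₂ y)
  rw [Finset.prod_const, Finset.card_univ, Fintype.card_fin] at this
  rw [this]
  exact Finset.sum_congr rfl fun _ _ => Finset.prod_mul_distrib

lemma sum_codeg_pow_mul {X Y : Type*} (Sx : Finset X) (Sy : Finset Y) (A : X → Y → ℝ) (k : ℕ)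
    (W : X → X → ℝ) :
    ∑ x₁ ∈ Sx, ∑ x₂ ∈ Sx, (∑ y ∈ Sy, A x₁ y * A x₂ y) ^ k * W x₁ x₂ =
      ∑ ys ∈ Fintype.piFinset (fun _ : Fin k => Sy), ∑ x₁ ∈ Sx, ∑ x₂ ∈ Sx,
        (∏ j, A x₁ (ys j)) * (∏ j, A x₂ (ys j)) * W x₁ x₂ := by
  simp only [codeg_pow, Finset.sum_mul]
  rw [Finset.sum_comm' (t' := Sx) (s' := fun _ => Fintype.piFinset fun _ : Fin k => Sy)
    (by simp [and_comm])]
  refine Finset.sum_congr rfl fun x _ => ?_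
  rw [Finset.sum_comm]

lemma codegMoment_eq_sum_sq {X Y : Type*} (Sx : Finset X) (Sy : Finset Y) (A : X → Y → ℝ)
    (k : ℕ) :
    codegMoment Sx Sy A k = ∑ ys ∈ Fintype.piFinset (fun _ : Fin k => Sy),
      (∑ x ∈ Sx, ∏ j, A x (ys j)) ^ 2 := by
  have := sum_codeg_pow_mul Sx Sy A k (fun _ _ => 1)
  simp only [mul_one] at this
  rw [codegMoment, this]
  exact Finset.sum_congr rfl fun ys _ => by rw [sq, Finset.sum_mul_sum]

lemma codegMoment_succ {X Y : Type*} (Sx : Finset X) (Sy : Finset Y) (A : X → Y → ℝ) (k : ℕ) :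
    codegMoment Sx Sy A (k + 1) = ∑ ys ∈ Fintype.piFinset (fun _ : Fin k => Sy),
      ∑ y ∈ Sy, (∑ x ∈ Sx, (∏ j, A x (ys j)) * A x y) ^ 2 := by
  simp only [codegMoment, pow_succ _ k]
  rw [sum_codeg_pow_mul]
  refine Finset.sum_congr rfl fun ys _ => ?_
  simp only [sq, Finset.sum_mul_sum]
  rw [Finset.sum_comm]
  conv_rhs => rw [Finset.sum_comm]
  rw [Finset.sum_comm]
  refine Finset.sum_congr rfl fun x _ => ?_
  rw [Finset.sum_comm]
  refine Finset.sum_congr rfl fun x' _ => ?_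
  rw [Finset.mul_sum]
  exact Finset.sum_congr rfl fun y _ => by ring

lemma gridSum_eq_codegMoment {X Y : Type*} (Sx : Finset X) (Sy : Finset Y) (A : X → Y → ℝ)
    (k : ℕ) :
    ∑ xs ∈ Fintype.piFinset (fun _ : Fin 2 => Sx),
      ∑ ys ∈ Fintype.piFinset (fun _ : Fin k => Sy), ∏ i : Fin 2, ∏ j : Fin k, A (xs i) (ys j)
      = codegMoment Sx Sy A k := by
  rw [codegMoment_eq_sum_sq, Finset.sum_comm]
  refine Finset.sum_congr rfl fun ys _ => ?_
  have := Finset.prod_univ_sum (fun _ : Fin 2 => Sx) (fun _ x => ∏ j, A x (ys j))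
  rw [← this, Fin.prod_univ_two, sq]

/-- If no large subrectangle of `Sx × Sy` is much denser than `β`, the codegree moments satisfy
an approximate geometric recursion. -/
lemma codegMoment_succ_le {X Y : Type*} {Sx : Finset X} {Sy : Finset Y} {A : X → Y → ℝ}
    {ε β p : ℝ} (hε : ε ∈ Set.Ioo (0 : ℝ) 1) (hβ : 0 < β) (hp : 0 < p) (hSx : Sx.Nonempty)
    (hSy : Sy.Nonempty) (hA : ZeroOne Sx Sy A)
    (H : ∀ X' ⊆ Sx, ∀ Y' ⊆ Sy, X'.Nonempty → Y'.Nonempty → p * Sx.card ≤ X'.card →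
      ε / 4 * β ^ 2 * Sy.card ≤ Y'.card → density X' Y' A ≤ (1 + ε / 4) * β) (k : ℕ) :
    codegMoment Sx Sy A (k + 1) ≤ p ^ 2 * ((Sx.card : ℝ) ^ 2 * (Sy.card : ℝ) ^ (k + 1))
      + (1 + ε) * β ^ 2 * Sy.card * codegMoment Sx Sy A k := by
  have hcx : (0 : ℝ) < Sx.card := by exact_mod_cast hSx.card_pos
  have hε0 : 0 < ε := hε.1
  classical
  have key : ∀ ys ∈ Fintype.piFinset (fun _ : Fin k => Sy),
      ∑ y ∈ Sy, (∑ x ∈ Sx, (∏ j, A x (ys j)) * A x y) ^ 2 ≤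
        p ^ 2 * ((Sx.card : ℝ) ^ 2 * Sy.card)
          + (1 + ε) * β ^ 2 * Sy.card * (∑ x ∈ Sx, ∏ j, A x (ys j)) ^ 2 := by
    intro ys hys
    rw [Fintype.mem_piFinset] at hys
    set X' := Sx.filter fun x => ∀ j, A x (ys j) = 1 with hX'
    have hind : ∀ x ∈ Sx, ∏ j, A x (ys j) = if ∀ j, A x (ys j) = 1 then 1 else 0 := by
      intro x hx
      split_ifs with h
      · exact Finset.prod_eq_one fun j _ => h j
      · push Not at h
        obtain ⟨j, hj⟩ := h
        exact Finset.prod_eq_zero (Finset.mem_univ j) ((hA x hx _ (hys j)).resolve_right hj)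
    have hsum : ∀ g : X → ℝ, ∑ x ∈ Sx, (∏ j, A x (ys j)) * g x = ∑ x ∈ X', g x := by
      intro g
      rw [hX', Finset.sum_filter]
      exact Finset.sum_congr rfl fun x hx => by rw [hind x hx]; split_ifs <;> simp
    have hcard : ∑ x ∈ Sx, ∏ j, A x (ys j) = X'.card := by
      have := hsum fun _ => 1
      simpa using this
    have hA' : ZeroOne X' Sy A := hA.mono (Finset.filter_subset _ _) subset_rfl
    rw [hcard]
    simp only [hsum]
    by_cases hbig : p * Sx.card ≤ X'.card
    · have hne : X'.Nonempty := by
        rw [← Finset.card_pos]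
        have : (0 : ℝ) < X'.card := lt_of_lt_of_le (by positivity) hbig
        exact_mod_cast this
      have := sum_sq_colSum_le hε hβ hne hSy hA' fun Y' hY' hY'ne hc =>
        H X' (Finset.filter_subset _ _) Y' hY' hne hY'ne hbig hc
      have h0 : 0 ≤ p ^ 2 * ((Sx.card : ℝ) ^ 2 * Sy.card) := by positivity
      linarith
    · have hcol : ∀ y ∈ Sy, (∑ x ∈ X', A x y) ^ 2 ≤ (p * Sx.card) ^ 2 := by
        intro y hy
        refine pow_le_pow_left₀ (Finset.sum_nonneg fun x hx => hA'.nonneg hx hy) ?_ 2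
        refine le_trans ?_ (not_le.1 hbig).le
        calc ∑ x ∈ X', A x y ≤ ∑ x ∈ X', (1 : ℝ) :=
              Finset.sum_le_sum fun x hx => hA'.le_one hx hy
          _ = _ := by simp
      have h1 := Finset.sum_le_sum hcol
      rw [Finset.sum_const, nsmul_eq_mul] at h1
      have h0 : 0 ≤ (1 + ε) * β ^ 2 * Sy.card * (X'.card : ℝ) ^ 2 := by positivity
      linarith
  rw [codegMoment_succ, codegMoment_eq_sum_sq, Finset.mul_sum]
  refine (Finset.sum_le_sum key).trans_eq ?_
  rw [Finset.sum_add_distrib, Finset.sum_const, nsmul_eq_mul, Fintype.card_piFinset_const]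
  push_cast
  ring

/-- A rectangle none of whose large subrectangles is much denser is grid regular. -/
lemma gridRegular_of_no_increment {X Y : Type*} {Sx : Finset X} {Sy : Finset Y} {A : X → Y → ℝ}
    {ε : ℝ} {d : ℕ} (hε : ε ∈ Set.Ioo (0 : ℝ) 1) (hd : 1 ≤ d) (hSx : Sx.Nonempty)
    (hSy : Sy.Nonempty) (hA : ZeroOne Sx Sy A) (hβ : 0 < density Sx Sy A)
    (H : ∀ X' ⊆ Sx, ∀ Y' ⊆ Sy, X'.Nonempty → Y'.Nonempty →
      ε ^ 2 / 4 * density Sx Sy A ^ (d + 2) * ((Sx.card : ℝ) * Sy.card)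
        ≤ (X'.card : ℝ) * Y'.card →
      density X' Y' A ≤ (1 + ε / 4) * density Sx Sy A) :
    GridRegular Sx Sy ε 2 d A := by
  have hcx : (0 : ℝ) < Sx.card := by exact_mod_cast hSx.card_pos
  have hcy : (0 : ℝ) < Sy.card := by exact_mod_cast hSy.card_pos
  have hβ1 : density Sx Sy A ≤ 1 := hA.density_le_one
  unfold GridRegular gridNorm
  set β := density Sx Sy A
  have hε0 : 0 < ε := hε.1
  have hε1 : ε < 1 := hε.2
  rw [gridSum_eq_codegMoment]
  have hrec := codegMoment_succ_le (p := ε * β ^ d) hε hβ (by positivity) hSx hSy hA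
    fun X' hX' Y' hY' hX'ne hY'ne h1 h2 => H X' hX' Y' hY' hX'ne hY'ne <| by
      have := mul_le_mul h1 h2 (by positivity) (by positivity)
      calc ε ^ 2 / 4 * β ^ (d + 2) * ((Sx.card : ℝ) * Sy.card)
          = ε * β ^ d * Sx.card * (ε / 4 * β ^ 2 * Sy.card) := by ring
        _ ≤ _ := this
  have hmom : ∀ k ≤ d, codegMoment Sx Sy A k ≤
      (((1 + ε) * β) ^ 2) ^ k * ((Sx.card : ℝ) ^ 2 * (Sy.card : ℝ) ^ k) := by
    intro k
    induction k with
    | zero => intro _; simp [codegMoment, sq]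
    | succ k ih =>
      intro hk
      have h1 := hrec k
      have h2 := mul_le_mul_of_nonneg_left (ih (by omega))
        (show 0 ≤ (1 + ε) * β ^ 2 * Sy.card by positivity)
      have hβpow : (β ^ d) ^ 2 ≤ (β ^ 2) ^ (k + 1) := by
        rw [← pow_mul, ← pow_mul]
        exact pow_le_pow_of_le_one hβ.le hβ1 (by omega)
      have h3 : (ε * β ^ d) ^ 2 + (1 + ε) * β ^ 2 * (((1 + ε) * β) ^ 2) ^ k
          ≤ (((1 + ε) * β) ^ 2) ^ (k + 1) := by
        have h4 : (β ^ 2) ^ k ≤ (((1 + ε) * β) ^ 2) ^ k := by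
          gcongr
          nlinarith
        have h5 : (ε * β ^ d) ^ 2 ≤ ε * (β ^ 2) ^ (k + 1) := by
          rw [mul_pow]
          exact mul_le_mul (by nlinarith) hβpow (by positivity) hε0.le
        have h6 : ε * (β ^ 2) ^ (k + 1) ≤ (ε + ε ^ 2) * β ^ 2 * (((1 + ε) * β) ^ 2) ^ k := by
          rw [pow_succ, mul_comm ((β ^ 2) ^ k), ← mul_assoc]
          gcongr
          nlinarith
        have h7 : (((1 + ε) * β) ^ 2) ^ (k + 1)
            = (ε + ε ^ 2) * β ^ 2 * (((1 + ε) * β) ^ 2) ^ k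
              + (1 + ε) * β ^ 2 * (((1 + ε) * β) ^ 2) ^ k := by
          rw [pow_succ]; ring
        linarith
      have h8 := mul_le_mul_of_nonneg_right h3
        (show 0 ≤ (Sx.card : ℝ) ^ 2 * (Sy.card : ℝ) ^ (k + 1) by positivity)
      calc _ ≤ _ := h1
        _ ≤ _ := add_le_add_right h2 _
        _ = _ := by ring
        _ ≤ _ := h8
  have hd0 : (0 : ℝ) < d := by exact_mod_cast hd
  have hnn : 0 ≤ codegMoment Sx Sy A d := by
    rw [codegMoment_eq_sum_sq]; positivity
  have hdiv : codegMoment Sx Sy A d / ((Sx.card : ℝ) ^ 2 * (Sy.card : ℝ) ^ d) ≤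
      ((1 + ε) * β) ^ (2 * d) := by
    rw [div_le_iff₀ (by positivity), pow_mul]
    exact hmom d le_rfl
  refine (Real.rpow_le_rpow (by positivity) hdiv (by positivity)).trans_eq ?_
  rw [← Real.rpow_natCast, ← Real.rpow_mul (by positivity)]
  push_cast
  rw [mul_one_div_cancel (by positivity), Real.rpow_one]

/-- Every row of a rectangle maximizing `density * area ^ γ` has nearly average degree. -/
lemma minDegree_of_max {X Y : Type*} {Sx : Finset X} {Sy : Finset Y} {A : X → Y → ℝ}
    {ε γ : ℝ} (hγ : 0 ≤ γ) (hγε : γ ≤ ε) (hε1 : ε ≤ 1) (hSx : Sx.Nonempty)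
    (hSy : Sy.Nonempty) (hβ : 0 < density Sx Sy A)
    (hmax : ∀ X' Y', X'.Nonempty → Y'.Nonempty →
      density X' Y' A * ((X'.card : ℝ) * Y'.card) ^ γ
        ≤ density Sx Sy A * ((Sx.card : ℝ) * Sy.card) ^ γ) :
    MinDegree Sx Sy ε A := by
  classical
  intro x hx
  by_contra! hlt
  have hcy : (0 : ℝ) < Sy.card := by exact_mod_cast hSy.card_pos
  have hsum := sum_eq_density_mul hSx hSy A
  rw [← Finset.add_sum_erase _ _ hx] at hsum
  have hrow : ∑ y ∈ Sy, A x y = rowDeg Sy A x * Sy.card := by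
    unfold rowDeg; field_simp
  have hcard : (Sx.card : ℝ) = (Sx.erase x).card + 1 := by
    exact_mod_cast (Finset.card_erase_add_one hx).symm
  rcases (Sx.erase x).eq_empty_or_nonempty with he | hne
  · rw [he] at hsum hcard
    rw [hcard, hrow] at hsum
    simp only [Finset.sum_empty, Finset.card_empty, Nat.cast_zero] at hsum
    have : rowDeg Sy A x = density Sx Sy A := by
      have := mul_right_cancel₀ hcy.ne' (show rowDeg Sy A x * (Sy.card : ℝ)
        = density Sx Sy A * Sy.card by linarith)
      exact this
    nlinarith
  · have hn : (0 : ℝ) < (Sx.erase x).card := by exact_mod_cast hne.card_pos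
    have hm := hmax _ _ hne hSy
    rw [sum_eq_density_mul hne hSy, hrow, hcard] at hsum
    rw [hcard] at hm
    set n : ℝ := ((Sx.erase x).card : ℝ)
    set β := density Sx Sy A
    set β' := density (Sx.erase x) Sy A
    have hdens : β * (n + ε) < β' * n := by
      have h1 : rowDeg Sy A x + β' * n = β * (n + 1) :=
        mul_right_cancel₀ hcy.ne' (by linarith)
      nlinarith
    rw [Real.mul_rpow hn.le hcy.le, Real.mul_rpow (by positivity) hcy.le, ← mul_assoc,
      ← mul_assoc] at hm
    have hm' := le_of_mul_le_mul_right hm (Real.rpow_pos_of_pos hcy γ)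
    have hnγ := Real.rpow_pos_of_pos hn γ
    have hbern : (n + 1) ^ γ ≤ n ^ γ * (1 + γ * (1 / n)) := by
      have h1 := rpow_one_add_le_one_add_mul_self (s := 1 / n) (p := γ)
        (by linarith [one_div_pos.2 hn]) hγ (hγε.trans hε1)
      have h2 : n + 1 = n * (1 + 1 / n) := by field_simp
      rw [h2, Real.mul_rpow hn.le (by positivity)]
      gcongr
    have h3 : β' * n ^ γ ≤ β * (1 + γ * (1 / n)) * n ^ γ := by
      calc β' * n ^ γ ≤ β * (n + 1) ^ γ := hm'
        _ ≤ β * (n ^ γ * (1 + γ * (1 / n))) := by gcongr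
        _ = _ := by ring
    have h4 := mul_le_mul_of_nonneg_right (le_of_mul_le_mul_right h3 hnγ) hn.le
    have h5 : β * (1 + γ * (1 / n)) * n = β * (n + γ) := by field_simp
    nlinarith

lemma exp_neg_le_sq_div_four_mul_pow {ε β : ℝ} {d : ℕ} (hε : ε ∈ Set.Ioo (0 : ℝ) 1) (hd : 1 ≤ d)
    (hβ : Real.exp (-d) ≤ β) :
    Real.exp (-(7 * d ^ 2 / ε)) ≤ ε ^ 2 / 4 * β ^ (d + 2) := by
  obtain ⟨hε0, hε1⟩ := hε
  have hd' : (1 : ℝ) ≤ d := by exact_mod_cast hd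
  have h1 : Real.exp (-(1 / ε)) ≤ ε := by
    rw [Real.exp_neg]
    refine inv_le_of_inv_le₀ hε0 ?_
    rw [← one_div]
    linarith [Real.add_one_le_exp (1 / ε)]
  have h2 : Real.exp (-1) ≤ 1 / 2 := by
    rw [Real.exp_neg, ← one_div]
    exact one_div_le_one_div_of_le two_pos (by linarith [Real.add_one_le_exp (1 : ℝ)])
  have hinv : 1 ≤ 1 / ε := by rw [le_div_iff₀ hε0]; linarith
  calc Real.exp (-(7 * d ^ 2 / ε))
      ≤ Real.exp (2 * -(1 / ε) + 2 * (-1) + (d + 2 : ℕ) * -(d : ℝ)) := by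
        apply Real.exp_le_exp.2
        have h3 : 7 * (d : ℝ) ^ 2 / ε = 7 * d ^ 2 * (1 / ε) := by ring
        rw [h3]
        push_cast
        have h4 : (d : ℝ) ≤ d ^ 2 := by nlinarith
        have h5 : (d : ℝ) ^ 2 ≤ d ^ 2 * (1 / ε) := by nlinarith
        have h6 : 1 / ε ≤ d ^ 2 * (1 / ε) := by nlinarith
        nlinarith
    _ = Real.exp (-(1 / ε)) ^ 2 * Real.exp (-1) ^ 2 * Real.exp (-d) ^ (d + 2) := by
        rw [Real.exp_add, Real.exp_add, Real.exp_nat_mul]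
        congr 1
        rw [← Real.exp_nat_mul, ← Real.exp_nat_mul]
        norm_num
    _ ≤ ε ^ 2 * (1 / 2) ^ 2 * β ^ (d + 2) := by gcongr
    _ = _ := by ring

/-- Every dense zero-one matrix contains a large rectangle that is at least as dense, grid regular
and of large minimum degree. -/
lemma exists_regular_rectangle {X Y : Type*} [Fintype X] [Fintype Y] [Nonempty X] [Nonempty Y]
    {A : X → Y → ℝ} (hA : ZeroOne Finset.univ Finset.univ A) {ε : ℝ} {d : ℕ}
    (hε : ε ∈ Set.Ioo (0 : ℝ) 1) (hd : 1 ≤ d)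
    (hdens : Real.exp (-d) ≤ density Finset.univ Finset.univ A) :
    ∃ (Sx : Finset X) (Sy : Finset Y), Sx.Nonempty ∧ Sy.Nonempty ∧
      density Finset.univ Finset.univ A ≤ density Sx Sy A ∧
      GridRegular Sx Sy ε 2 d A ∧ MinDegree Sx Sy ε A ∧
      Real.exp (-(35 * d ^ 3 / ε ^ 2)) * ((Fintype.card X : ℝ) * Fintype.card Y)
        ≤ (Sx.card : ℝ) * Sy.card := by
  classical
  have hε0 : 0 < ε := hε.1
  have hε1 : ε < 1 := hε.2
  have hd' : (1 : ℝ) ≤ d := by exact_mod_cast hd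
  set γ : ℝ := ε ^ 2 / (35 * d ^ 2) with hγ
  have hγ0 : 0 < γ := by positivity
  have hγε : γ ≤ ε := by
    rw [hγ, div_le_iff₀ (by positivity)]
    have : (1 : ℝ) ≤ d ^ 2 := by nlinarith
    nlinarith
  obtain ⟨⟨Sx, Sy⟩, hmem, hmax⟩ := Finset.exists_max_image
    (Finset.univ.filter fun R : Finset X × Finset Y => R.1.Nonempty ∧ R.2.Nonempty)
    (fun R => density R.1 R.2 A * ((R.1.card : ℝ) * R.2.card) ^ γ)
    ⟨(Finset.univ, Finset.univ), by simp⟩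
  simp only [Finset.mem_filter, Finset.mem_univ, true_and, Prod.forall, and_imp] at hmem hmax
  obtain ⟨hSx, hSy⟩ := hmem
  have hu := hmax _ _ Finset.univ_nonempty Finset.univ_nonempty
  rw [Finset.card_univ, Finset.card_univ] at hu
  have hcx : (0 : ℝ) < Sx.card := by exact_mod_cast hSx.card_pos
  have hcy : (0 : ℝ) < Sy.card := by exact_mod_cast hSy.card_pos
  have hX : (0 : ℝ) < Fintype.card X := by exact_mod_cast Fintype.card_pos
  have hY : (0 : ℝ) < Fintype.card Y := by exact_mod_cast Fintype.card_pos
  have hAS : ZeroOne Sx Sy A := hA.mono (Finset.subset_univ _) (Finset.subset_univ _)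
  have hdens0 : 0 < density Finset.univ Finset.univ A := (Real.exp_pos _).trans_le hdens
  have hsN : (Sx.card : ℝ) * Sy.card ≤ Fintype.card X * Fintype.card Y := by
    have h1 : (Sx.card : ℝ) ≤ Fintype.card X := by exact_mod_cast Finset.card_le_univ Sx
    have h2 : (Sy.card : ℝ) ≤ Fintype.card Y := by exact_mod_cast Finset.card_le_univ Sy
    gcongr
  have hsγ := Real.rpow_pos_of_pos (mul_pos hcx hcy) γ
  have hNγ := Real.rpow_pos_of_pos (mul_pos hX hY) γ
  have hβ0 : 0 < density Sx Sy A :=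
    pos_of_mul_pos_left ((mul_pos hdens0 hNγ).trans_le hu) hsγ.le
  have hinc : density Finset.univ Finset.univ A ≤ density Sx Sy A := by
    have h1 : density Sx Sy A * ((Sx.card : ℝ) * Sy.card) ^ γ
        ≤ density Sx Sy A * ((Fintype.card X : ℝ) * Fintype.card Y) ^ γ := by gcongr
    exact le_of_mul_le_mul_right (hu.trans h1) hNγ
  refine ⟨Sx, Sy, hSx, hSy, hinc, ?_,
    minDegree_of_max hγ0.le hγε hε1.le hSx hSy hβ0 hmax, ?_⟩
  · refine gridRegular_of_no_increment hε hd hSx hSy hAS hβ0 fun X' _ Y' _ hX' hY' hle => ?_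
    have hm := hmax X' Y' hX' hY'
    have hexp := exp_neg_le_sq_div_four_mul_pow hε hd (hdens.trans hinc)
    set β := density Sx Sy A
    by_cases hD : density X' Y' A ≤ 0
    · exact hD.trans (by positivity)
    push Not at hD
    have h1 : Real.exp (-(ε / 5)) * ((Sx.card : ℝ) * Sy.card) ^ γ
        ≤ ((X'.card : ℝ) * Y'.card) ^ γ := by
      have h2 : Real.exp (-(ε / 5)) = Real.exp (-(7 * d ^ 2 / ε)) ^ γ := by
        rw [← Real.exp_mul, hγ]
        congr 1
        field_simp
        ring
      rw [h2, ← Real.mul_rpow (Real.exp_pos _).le (by positivity)]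
      refine Real.rpow_le_rpow (by positivity) (le_trans ?_ hle) hγ0.le
      gcongr
    have h3 : density X' Y' A * Real.exp (-(ε / 5)) ≤ β := by
      refine le_of_mul_le_mul_right ?_ hsγ
      refine le_trans ?_ hm
      rw [mul_assoc]
      gcongr
    have h4 : 1 ≤ Real.exp (-(ε / 5)) * (1 + ε / 4) := by
      have := mul_le_mul_of_nonneg_right (Real.add_one_le_exp (-(ε / 5)))
        (show 0 ≤ 1 + ε / 4 by positivity)
      nlinarith
    calc density X' Y' A ≤ density X' Y' A * (Real.exp (-(ε / 5)) * (1 + ε / 4)) :=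
          le_mul_of_one_le_right hD.le h4
      _ = (1 + ε / 4) * (density X' Y' A * Real.exp (-(ε / 5))) := by ring
      _ ≤ _ := by gcongr
  · rw [← Real.rpow_le_rpow_iff (by positivity) (by positivity) hγ0,
      Real.mul_rpow (Real.exp_pos _).le (by positivity), ← Real.exp_mul]
    have h1 : -(35 * (d : ℝ) ^ 3 / ε ^ 2) * γ = -d := by
      rw [hγ]; field_simp
    rw [h1]
    calc Real.exp (-d) * ((Fintype.card X : ℝ) * Fintype.card Y) ^ γ
        ≤ density Finset.univ Finset.univ A * ((Fintype.card X : ℝ) * Fintype.card Y) ^ γ := by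
          gcongr
      _ ≤ _ := hu
      _ ≤ 1 * _ := by gcongr; exact hAS.density_le_one
      _ = _ := one_mul _

open scoped Classical

/-- Bound, relative to the area of the ambient rectangle, on the total area of the pieces of a
decomposition of a matrix with density `μ`, where pieces of density at most `τ` are left alone. -/
noncomputable def areaBudget (τ μ : ℝ) : ℝ :=
  1 + if μ ≤ τ then 0 else 1 + Real.log (μ / τ)

lemma areaBudget_step {τ μ μ' s : ℝ} (hτ : 0 < τ) (hμ : τ < μ) (hs : s ≤ 1)
    (hμ' : μ' ≤ μ - s * μ) : s + areaBudget τ μ' ≤ areaBudget τ μ := by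
  unfold areaBudget
  rw [if_neg (not_le.2 hμ)]
  have hlog : 0 ≤ Real.log (μ / τ) := Real.log_nonneg ((one_le_div hτ).2 hμ.le)
  have hμ0 := hτ.trans hμ
  split_ifs with h
  · linarith
  · push Not at h
    have hμ'0 := hτ.trans h
    have h1 : s ≤ 1 - μ' / μ := by
      rw [le_sub_comm, div_le_iff₀ hμ0]; linarith
    have h2 := Real.log_le_sub_one_of_pos (div_pos hμ'0 hμ0)
    rw [Real.log_div hμ'0.ne' hμ0.ne'] at h2
    rw [Real.log_div hμ'0.ne' hτ.ne', Real.log_div hμ0.ne' hτ.ne']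
    linarith

lemma exists_list_decomposition {X Y : Type*} [Fintype X] [Fintype Y] [Nonempty X] [Nonempty Y]
    {ε τ : ℝ} {d : ℕ} (hε : ε ∈ Set.Ioo (0 : ℝ) 1) (hd : 1 ≤ d) (hτ : Real.exp (-d) ≤ τ)
    (n : ℕ) (A : X → Y → ℝ) (hA : ZeroOne Finset.univ Finset.univ A)
    (hn : ∑ x, ∑ y, A x y ≤ n * τ) :
    ∃ l : List (Finset X × Finset Y × (X → Y → ℝ)), l ≠ [] ∧
      (∀ t ∈ l, t.1.Nonempty ∧ t.2.1.Nonempty ∧ ZeroOne t.1 t.2.1 t.2.2 ∧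
        (density t.1 t.2.1 t.2.2 ≤ τ ∨
          (GridRegular t.1 t.2.1 ε 2 d t.2.2 ∧ MinDegree t.1 t.2.1 ε t.2.2)) ∧
        Real.exp (-(35 * d ^ 3 / ε ^ 2)) * ((Fintype.card X : ℝ) * Fintype.card Y)
          ≤ (t.1.card : ℝ) * t.2.1.card) ∧
      (∀ x y, A x y = (l.map fun t => if x ∈ t.1 ∧ y ∈ t.2.1 then t.2.2 x y else 0).sum) ∧
      (l.map fun t => (t.1.card : ℝ) * t.2.1.card).sum ≤
        areaBudget τ (density Finset.univ Finset.univ A)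
          * ((Fintype.card X : ℝ) * Fintype.card Y) := by
  have hε0 : 0 < ε := hε.1
  have hτ0 : 0 < τ := (Real.exp_pos _).trans_le hτ
  have hX : (0 : ℝ) < Fintype.card X := by exact_mod_cast Fintype.card_pos
  have hY : (0 : ℝ) < Fintype.card Y := by exact_mod_cast Fintype.card_pos
  have hN : 0 < (Fintype.card X : ℝ) * Fintype.card Y := mul_pos hX hY
  have hsparse : ∀ B : X → Y → ℝ, ZeroOne Finset.univ Finset.univ B →
      density Finset.univ Finset.univ B ≤ τ →
      ∃ l : List (Finset X × Finset Y × (X → Y → ℝ)), l ≠ [] ∧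
      (∀ t ∈ l, t.1.Nonempty ∧ t.2.1.Nonempty ∧ ZeroOne t.1 t.2.1 t.2.2 ∧
        (density t.1 t.2.1 t.2.2 ≤ τ ∨
          (GridRegular t.1 t.2.1 ε 2 d t.2.2 ∧ MinDegree t.1 t.2.1 ε t.2.2)) ∧
        Real.exp (-(35 * d ^ 3 / ε ^ 2)) * ((Fintype.card X : ℝ) * Fintype.card Y)
          ≤ (t.1.card : ℝ) * t.2.1.card) ∧
      (∀ x y, B x y = (l.map fun t => if x ∈ t.1 ∧ y ∈ t.2.1 then t.2.2 x y else 0).sum) ∧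
      (l.map fun t => (t.1.card : ℝ) * t.2.1.card).sum ≤
        areaBudget τ (density Finset.univ Finset.univ B)
          * ((Fintype.card X : ℝ) * Fintype.card Y) := by
    intro B hB hBτ
    refine ⟨[(Finset.univ, Finset.univ, B)], by simp, ?_, by simp, by simp [areaBudget, hBτ]⟩
    intro t ht
    rw [List.mem_singleton] at ht
    subst ht
    refine ⟨Finset.univ_nonempty, Finset.univ_nonempty, hB, Or.inl hBτ, ?_⟩
    refine mul_le_of_le_one_left (by positivity) (Real.exp_le_one_iff.2 ?_)
    rw [neg_nonpos]
    positivity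
  have htotal : ∀ B : X → Y → ℝ, ∑ x, ∑ y, B x y = density Finset.univ Finset.univ B
      * ((Fintype.card X : ℝ) * Fintype.card Y) := fun B => by
    rw [sum_eq_density_mul Finset.univ_nonempty Finset.univ_nonempty, Finset.card_univ,
      Finset.card_univ]
  induction n generalizing A with
  | zero =>
    refine hsparse A hA ?_
    rw [htotal] at hn
    push_cast at hn
    nlinarith
  | succ n ih =>
    rcases le_or_gt (density Finset.univ Finset.univ A) τ with hle | hlt
    · exact hsparse A hA hle
    obtain ⟨Sx, Sy, hSx, hSy, hinc, hreg, hmin, hsize⟩ :=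
      exists_regular_rectangle hA hε hd (hτ.trans hlt.le)
    set B : X → Y → ℝ := fun x y => if x ∈ Sx ∧ y ∈ Sy then 0 else A x y with hBdef
    have hB : ZeroOne Finset.univ Finset.univ B := by
      intro x hx y hy
      simp only [hBdef]
      split_ifs
      · exact Or.inl rfl
      · exact hA x hx y hy
    have hsplit : ∀ x y, A x y = (if x ∈ Sx ∧ y ∈ Sy then A x y else 0) + B x y := by
      intro x y
      simp only [hBdef]
      split_ifs <;> simp
    have hsum : ∑ x, ∑ y, A x y = ∑ x ∈ Sx, ∑ y ∈ Sy, A x y + ∑ x, ∑ y, B x y := by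
      rw [Finset.sum_congr rfl fun x _ => Finset.sum_congr rfl fun y _ => hsplit x y]
      simp only [Finset.sum_add_distrib, ite_and]
      congr 1
      have hinner : ∀ x, ∑ y, (if x ∈ Sx then if y ∈ Sy then A x y else 0 else 0) =
          if x ∈ Sx then ∑ y ∈ Sy, A x y else 0 := fun x => by
        split_ifs <;> simp
      simp [hinner]
    have hcx : (1 : ℝ) ≤ Sx.card := by exact_mod_cast hSx.card_pos
    have hcy : (1 : ℝ) ≤ Sy.card := by exact_mod_cast hSy.card_pos
    have hs1 : 1 ≤ (Sx.card : ℝ) * Sy.card := one_le_mul_of_one_le_of_one_le hcx hcy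
    have hpiece := sum_eq_density_mul hSx hSy A
    have hBn : ∑ x, ∑ y, B x y ≤ n * τ := by
      push_cast at hn
      nlinarith
    obtain ⟨l, -, hgood, hdec, harea⟩ := ih B hB hBn
    refine ⟨(Sx, Sy, A) :: l, by simp, ?_, ?_, ?_⟩
    · intro t ht
      rcases List.mem_cons.1 ht with rfl | ht
      · exact ⟨hSx, hSy, hA.mono (Finset.subset_univ _) (Finset.subset_univ _),
          Or.inr ⟨hreg, hmin⟩, hsize⟩
      · exact hgood t ht
    · intro x y
      rw [List.map_cons, List.sum_cons, ← hdec, ← hsplit]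
    · rw [List.map_cons, List.sum_cons]
      have hsN : (Sx.card : ℝ) * Sy.card ≤ Fintype.card X * Fintype.card Y := by
        have h1 : (Sx.card : ℝ) ≤ Fintype.card X := by exact_mod_cast Finset.card_le_univ Sx
        have h2 : (Sy.card : ℝ) ≤ Fintype.card Y := by exact_mod_cast Finset.card_le_univ Sy
        exact mul_le_mul h1 h2 (Nat.cast_nonneg _) (Nat.cast_nonneg _)
      have hstep := areaBudget_step (μ' := density Finset.univ Finset.univ B) hτ0 hlt
        ((div_le_one hN).2 hsN) (by
          refine le_of_mul_le_mul_right ?_ hN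
          rw [← htotal, sub_mul, ← htotal, hsum, hpiece, mul_right_comm,
            div_mul_cancel₀ _ hN.ne']
          nlinarith)
      have := mul_le_mul_of_nonneg_right hstep hN.le
      rw [add_mul, div_mul_cancel₀ _ hN.ne'] at this
      linarith

lemma areaBudget_two_rpow_le {μ : ℝ} {d : ℕ} (hμ : μ ≤ 1) :
    areaBudget ((2 : ℝ) ^ (-(d : ℝ))) μ ≤ d + 2 := by
  unfold areaBudget
  have hd : (0 : ℝ) ≤ d := d.cast_nonneg
  split_ifs with h
  · linarith
  · push Not at h
    have hτ : (0 : ℝ) < 2 ^ (-(d : ℝ)) := by positivity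
    have h1 := Real.log_nonpos (hτ.trans h).le hμ
    rw [Real.log_div (hτ.trans h).ne' hτ.ne', Real.log_rpow two_pos]
    have h2 : Real.log 2 ≤ 1 := by linarith [Real.log_two_lt_d9]
    nlinarith

/-- **A-Decomposition (existential content).** There are universal constants `c, C > 0` such
that every zero-one matrix `A` on finite nonempty `X × Y` admits, for every `ε ∈ (0,1)` and
integer `d ≥ 1`, a decomposition `{(X_ℓ, Y_ℓ, A_ℓ)}_{ℓ=1}^L` with: (1) `A = Σ_ℓ A_ℓ`
(extending each `A_ℓ` by zeros); (2) each piece is `2^{−d}`-sparse or both `(ε,2,d)`-regular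
and `ε`-min-degree; (3) `Σ_ℓ |X_ℓ||Y_ℓ| ≤ (d+2)|X||Y|`; (4) `L ≤ exp(C·d³·ε^{−c})` and every
piece has `|X_ℓ||Y_ℓ| ≥ exp(−C·d³·ε^{−c})·|X||Y|`. -/
theorem A_decomposition :
    ∃ c C : ℝ, 0 < c ∧ 0 < C ∧
    ∀ (X Y : Type) [Fintype X] [Fintype Y] [Nonempty X] [Nonempty Y]
      (A : X → Y → ℝ), ZeroOne Finset.univ Finset.univ A →
      ∀ (ε : ℝ) (d : ℕ), ε ∈ Set.Ioo (0 : ℝ) 1 → 1 ≤ d →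
      ∃ (L : ℕ) (Xl : Fin L → Finset X) (Yl : Fin L → Finset Y) (Al : Fin L → X → Y → ℝ),
        1 ≤ L ∧
        (∀ i, (Xl i).Nonempty ∧ (Yl i).Nonempty ∧ ZeroOne (Xl i) (Yl i) (Al i)) ∧
        (∀ x y, A x y = ∑ i : Fin L, if x ∈ Xl i ∧ y ∈ Yl i then Al i x y else 0) ∧
        (∀ i, density (Xl i) (Yl i) (Al i) ≤ (2 : ℝ) ^ (-(d : ℝ)) ∨
          (GridRegular (Xl i) (Yl i) ε 2 d (Al i) ∧ MinDegree (Xl i) (Yl i) ε (Al i))) ∧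
        (∑ i : Fin L, ((Xl i).card : ℝ) * ((Yl i).card : ℝ)
            ≤ ((d : ℝ) + 2) * ((Fintype.card X : ℝ) * (Fintype.card Y : ℝ))) ∧
        (L : ℝ) ≤ Real.exp (C * (d : ℝ) ^ 3 * ε ^ (-c)) ∧
        (∀ i, Real.exp (-(C * (d : ℝ) ^ 3 * ε ^ (-c)))
            * ((Fintype.card X : ℝ) * (Fintype.card Y : ℝ))
          ≤ ((Xl i).card : ℝ) * ((Yl i).card : ℝ)) := by
  refine ⟨2, 38, two_pos, by norm_num, ?_⟩
  intro X Y _ _ _ _ A hA ε d hε hd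
  have hε0 : 0 < ε := hε.1
  have hε1 : ε < 1 := hε.2
  have hd' : (1 : ℝ) ≤ d := by exact_mod_cast hd
  have hX : (0 : ℝ) < Fintype.card X := by exact_mod_cast Fintype.card_pos
  have hY : (0 : ℝ) < Fintype.card Y := by exact_mod_cast Fintype.card_pos
  have hN : 0 < (Fintype.card X : ℝ) * Fintype.card Y := mul_pos hX hY
  have hτ : Real.exp (-d) ≤ (2 : ℝ) ^ (-(d : ℝ)) := by
    rw [Real.rpow_def_of_pos two_pos]
    apply Real.exp_le_exp.2
    have h2 : Real.log 2 ≤ 1 := by linarith [Real.log_two_lt_d9]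
    nlinarith
  obtain ⟨n, hn⟩ := exists_nat_ge ((∑ x, ∑ y, A x y) / (2 : ℝ) ^ (-(d : ℝ)))
  rw [div_le_iff₀ (by positivity)] at hn
  obtain ⟨l, hl, hgood, hdec, harea⟩ := exists_list_decomposition hε hd hτ n A hA hn
  have hrpow : ε ^ (-2 : ℝ) = 1 / ε ^ 2 := by
    rw [Real.rpow_neg hε0.le, ← one_div]
    norm_cast
  set E : ℝ := d ^ 3 / ε ^ 2 with hE
  have hE38 : 38 * (d : ℝ) ^ 3 * ε ^ (-2 : ℝ) = 38 * E := by rw [hrpow, hE]; ring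
  have hE35 : 35 * (d : ℝ) ^ 3 / ε ^ 2 = 35 * E := by rw [hE]; ring
  have hEd : (d : ℝ) ≤ E := by
    rw [hE, le_div_iff₀ (by positivity)]
    have h1 : (d : ℝ) ≤ d ^ 3 := le_self_pow₀ hd' (by norm_num)
    have h2 : ε ^ 2 ≤ 1 := pow_le_one₀ hε0.le hε1.le
    nlinarith
  rw [hE38]
  simp only [hE35] at hgood
  have harea' : (l.map fun t => (t.1.card : ℝ) * t.2.1.card).sum ≤
      ((d : ℝ) + 2) * ((Fintype.card X : ℝ) * Fintype.card Y) :=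
    harea.trans (by gcongr; exact areaBudget_two_rpow_le hA.density_le_one)
  have hget : ∀ i : Fin l.length, l[i] ∈ l := fun i => List.getElem_mem _
  refine ⟨l.length, fun i => l[i].1, fun i => l[i].2.1, fun i => l[i].2.2,
    List.length_pos_of_ne_nil hl, fun i => ?_, fun x y => ?_, fun i => ?_, ?_, ?_, fun i => ?_⟩
  · obtain ⟨h1, h2, h3, -⟩ := hgood _ (hget i)
    exact ⟨h1, h2, h3⟩
  · rw [hdec]
    exact (Fin.sum_univ_fun_getElem l
      (fun t => if x ∈ t.1 ∧ y ∈ t.2.1 then t.2.2 x y else 0)).symm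
  · exact (hgood _ (hget i)).2.2.2.1
  · exact (Fin.sum_univ_fun_getElem l fun t => (t.1.card : ℝ) * t.2.1.card).trans_le harea'
  · have hcount : (l.length : ℝ) *
        (Real.exp (-(35 * E)) * ((Fintype.card X : ℝ) * Fintype.card Y)) ≤
        (l.map fun t => (t.1.card : ℝ) * t.2.1.card).sum := by
      have := List.card_nsmul_le_sum (l.map fun t => (t.1.card : ℝ) * t.2.1.card)
        (Real.exp (-(35 * E)) * ((Fintype.card X : ℝ) * Fintype.card Y)) (by
          intro r hr
          obtain ⟨t, ht, rfl⟩ := List.mem_map.1 hr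
          exact (hgood t ht).2.2.2.2)
      rwa [List.length_map, nsmul_eq_mul] at this
    have h1 := hcount.trans harea'
    rw [← mul_assoc] at h1
    have h2 := le_of_mul_le_mul_right h1 hN
    rw [Real.exp_neg, ← div_eq_mul_inv, div_le_iff₀ (Real.exp_pos _)] at h2
    calc (l.length : ℝ) ≤ (d + 2) * Real.exp (35 * E) := h2
      _ ≤ Real.exp (d + 1 + 1) * Real.exp (35 * E) := by
        gcongr
        linarith [Real.add_one_le_exp ((d : ℝ) + 1 + 1)]
      _ = Real.exp (d + 1 + 1 + 35 * E) := (Real.exp_add _ _).symm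
      _ ≤ Real.exp (38 * E) := Real.exp_le_exp.2 (by linarith)
  · refine le_trans ?_ (hgood _ (hget i)).2.2.2.2
    gcongr
    linarith
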